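/- For every subset S of the vertex set of L⁽²⁾, if ω′ denotes the number of connected components of L⁽²⁾∖S that contain neither x = w₁ nor y = w₅, then ω′ ≤ 2 and |S| ≥ (3/2)·ω′. -/

import Mathlib

open SimpleGraph

/-- Number of connected components of the subgraph induced on the complement of `S`. -/
noncomputable def numComponents {V : Type} (G : SimpleGraph V) (S : Set V) : ℕ :=
  Nat.card (G.induce Sᶜ).ConnectedComponent

/-- `G` is `t`-tough: `|S| ≥ t · ω(G \ S)` for every vertex subset `S`
with `ω(G \ S) > 1`. -/
def IsTough {V : Type} (t : ℝ) (G : SimpleGraph V) : Prop :=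
  ∀ S : Finset V, 1 < numComponents G ↑S →
    t * (numComponents G ↑S : ℝ) ≤ (S.card : ℝ)

/-- The toughness of `G` equals `t`: `t` is the greatest nonnegative real
for which `G` is `t`-tough. -/
def HasToughness {V : Type} (G : SimpleGraph V) (t : ℝ) : Prop :=
  IsGreatest {s : ℝ | 0 ≤ s ∧ IsTough s G} t

/-- A Hamiltonian cycle: a cycle whose support contains every vertex. -/
def IsHamCycle {V : Type} {G : SimpleGraph V} {v : V} (p : G.Walk v v) : Prop :=
  p.IsCycle ∧ ∀ u, u ∈ p.support

/-- A graph is Hamiltonian if it contains a Hamiltonian cycle. -/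
def IsHam {V : Type} (G : SimpleGraph V) : Prop :=
  ∃ (v : V) (p : G.Walk v v), IsHamCycle p

/-- `x` and `y` are connected by a Hamilton path of `G`: a path with endpoints
`x` and `y` containing every vertex of `G`. -/
def HamConnected {V : Type} (G : SimpleGraph V) (x y : V) : Prop :=
  ∃ p : G.Walk x y, p.IsPath ∧ ∀ v, v ∈ p.support

/-- The number of connected components of the subgraph of `G` induced on the
complement of `S` that contain neither `x` nor `y`. -/
noncomputable def numCompAvoiding {V : Type} (G : SimpleGraph V) (S : Set V)
    (x y : V) : ℕ :=
  Nat.card {c : (G.induce Sᶜ).ConnectedComponent //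
    ∀ v : ↥Sᶜ, (G.induce Sᶜ).connectedComponentMk v = c → (v : V) ≠ x ∧ (v : V) ≠ y}

/-- `L⁽²⁾`: obtained from `L⁽¹⁾` by deleting `w₁w₂, w₂w₈` and identifying
`w₂` with `w₈`.  Vertices `w₁, w, w₃, w₄, w₅, w₆, w₇` are
`0, 1, 2, 3, 4, 5, 6`; `x = w₁ = 0`, `y = w₅ = 4`. -/
def L2 : SimpleGraph (Fin 7) := SimpleGraph.fromEdgeSet
  {s(0,1), s(1,2), s(2,3), s(3,4), s(4,5), s(5,6), s(6,1),
   s(1,3), s(3,5), s(5,1)}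

/-- If every vertex outside `S` can be joined in `G \ S` to `x`, to `y` or to a member of `R`, then
at most `#R` components of `G \ S` avoid both `x` and `y`. -/
theorem numCompAvoiding_le_card {V : Type} {G : SimpleGraph V} {S : Set V} {x y : V}
    (R : Finset V)
    (h : ∀ v : ↥Sᶜ, ∃ r : ↥Sᶜ, ((r : V) = x ∨ (r : V) = y ∨ (r : V) ∈ R) ∧
      (G.induce Sᶜ).Reachable r v) :
    numCompAvoiding G S x y ≤ R.card := by
  have key : ∀ c : {c : (G.induce Sᶜ).ConnectedComponent //
      ∀ v : ↥Sᶜ, (G.induce Sᶜ).connectedComponentMk v = c → (v : V) ≠ x ∧ (v : V) ≠ y},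
      ∃ r : ↥Sᶜ, (r : V) ∈ R ∧ (G.induce Sᶜ).connectedComponentMk r = c := by
    rintro ⟨c, hc⟩
    induction c using ConnectedComponent.ind with
    | _ v =>
      obtain ⟨r, hr, hrv⟩ := h v
      have hmk := ConnectedComponent.sound hrv
      have hne := hc r hmk
      exact ⟨r, (hr.resolve_left hne.1).resolve_left hne.2, hmk⟩
  choose f hfR hfc using key
  have hinj : Function.Injective fun c => (⟨f c, hfR c⟩ : R) := by
    intro c d hcd
    have hfcd : f c = f d := Subtype.ext (congrArg (fun r : R => (r : V)) hcd)
    exact Subtype.ext ((hfc c).symm.trans (hfcd ▸ hfc d))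
  simpa [numCompAvoiding] using Nat.card_le_card_of_injective _ hinj

instance : DecidableRel L2.Adj := fun u v =>
  decidable_of_iff (s(u, v) ∈ ({s(0,1), s(1,2), s(2,3), s(3,4), s(4,5), s(5,6), s(6,1),
    s(1,3), s(3,5), s(5,1)} : Finset (Sym2 (Fin 7))) ∧ u ≠ v) (by simp [L2])

/-- After deleting `S` from `L⁽²⁾`, every vertex is within distance two of `x`, of `y` or of a
small set `R`. -/
theorem L2_exists_dominating (S : Finset (Fin 7)) :
    ∃ R ∈ ([∅, {1}, {3}, {5}, {2}, {6}, {2, 6}, {3, 6}, {2, 5}] : List (Finset (Fin 7))),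
      3 * R.card ≤ 2 * S.card ∧
      ∀ v, v ∉ S → ∃ r, r ∉ S ∧ (r = 0 ∨ r = 4 ∨ r ∈ R) ∧
        ∃ u, u ∉ S ∧ (r = u ∨ L2.Adj r u) ∧ (u = v ∨ L2.Adj u v) := by
  revert S
  decide +kernel

/-- For every vertex subset `S` of `L⁽²⁾`, the number `ω'` of components of
`L⁽²⁾ \ S` containing neither `x = w₁` nor `y = w₅` satisfies `ω' ≤ 2` and
`|S| ≥ (3/2)ω'`. -/
theorem L2_components_bound (S : Finset (Fin 7)) :
    numCompAvoiding L2 ↑S 0 4 ≤ 2 ∧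
      (3 / 2 : ℝ) * (numCompAvoiding L2 ↑S 0 4 : ℝ) ≤ (S.card : ℝ) := by
  obtain ⟨R, hR, hcard, hdom⟩ := L2_exists_dominating S
  have hR2 : R.card ≤ 2 := by
    clear hcard hdom
    revert R
    decide +kernel
  have hle : numCompAvoiding L2 ↑S 0 4 ≤ R.card := by
    refine numCompAvoiding_le_card R ?_
    rintro ⟨v, hv⟩
    obtain ⟨r, hr, hrR, u, hu, hru, huv⟩ := hdom v (by simpa using hv)
    have step : ∀ {a b : Fin 7} (ha : a ∉ S) (hb : b ∉ S), a = b ∨ L2.Adj a b →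
        (L2.induce (↑S : Set (Fin 7))ᶜ).Reachable ⟨a, by simpa using ha⟩
          ⟨b, by simpa using hb⟩ := by
      rintro a b ha hb (rfl | hab)
      · exact Reachable.refl _
      · exact Adj.reachable (by simpa using hab)
    exact ⟨⟨r, by simpa using hr⟩, hrR,
      (step hr hu hru).trans (step hu (by simpa using hv) huv)⟩
  refine ⟨hle.trans hR2, ?_⟩
  have h3 : 3 * numCompAvoiding L2 ↑S 0 4 ≤ 2 * S.card := by omega
  have h3' : (3 : ℝ) * (numCompAvoiding L2 ↑S 0 4 : ℝ) ≤ 2 * (S.card : ℝ) := by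
    exact_mod_cast h3
  linarith
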